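/- arXiv:2405.14395 — 2 statements merged into one kernel-verified Lean document; each statement's English description precedes it below -/
import Mathlib

section
/- Let G be a finite group, H ≤ G a subgroup, and M a finite-dimensional complex representation of H. Let x = Σ_{g∈G} c_g g be a central element of the group algebra ℂG, and let x' = Σ_{g∈H} c_g g ∈ ℂH be its truncation to H. If x acts on the induced representation Ind_H^G M by the scalar c, then x' acts on M by the same scalar c. -/
/-!
STATEMENT 13. Let G be a finite group, H ≤ G, M a finite-dimensional complex
representation of H. Let x = Σ c_g g be central in ℂG and x' = Σ_{g ∈ H} c_g g ∈ ℂH its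
truncation to H. If x acts on Ind_H^G M by the scalar c, then x' acts on M by c.

The induced representation `Ind_H^G M` is modelled by any G-representation N equipped
with an injective H-equivariant linear map ι : M → N whose G-translates span N and with
dim N = [G:H]·dim M; these properties characterize Ind_H^G M up to isomorphism.
-/

/-- The truncation of an element of `ℂ[G]` to the subgroup `H`: keep only the
coefficients of group elements lying in `H`. -/
noncomputable def truncateToSubgroup {G : Type*} [Group G] (H : Subgroup G)
    (x : MonoidAlgebra ℂ G) : MonoidAlgebra ℂ H :=
  MonoidAlgebra.ofCoeff
    (Finsupp.comapDomain (Subtype.val : H → G) x.coeff (Subtype.val_injective.injOn))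

lemma asAlgebraHom_eq_sum {K V : Type*} [Group K] [Fintype K] [AddCommGroup V] [Module ℂ V]
    (ρ : Representation ℂ K V) (y : MonoidAlgebra ℂ K) (v : V) :
    ρ.asAlgebraHom y v = ∑ g : K, y.coeff g • ρ g v := by
  rw [Representation.asAlgebraHom_def, MonoidAlgebra.lift_apply, Finsupp.sum_fintype]
  · simp
  · simp

theorem stmt_13 {G : Type*} [Group G] [Finite G] (H : Subgroup G)
    {M N : Type*} [AddCommGroup M] [Module ℂ M] [FiniteDimensional ℂ M]
    [AddCommGroup N] [Module ℂ N] [FiniteDimensional ℂ N]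
    (ρM : Representation ℂ H M) (ρN : Representation ℂ G N)
    -- `(N, ι)` is a model of the induced representation `Ind_H^G M`:
    (ι : M →ₗ[ℂ] N)
    (hinj : Function.Injective ι)
    (hequiv : ∀ (h : H) (m : M), ι (ρM h m) = ρN (h : G) (ι m))
    (hgen : Submodule.span ℂ {v : N | ∃ (g : G) (m : M), v = ρN g (ι m)} = ⊤)
    (hdim : Module.finrank ℂ N = H.index * Module.finrank ℂ M)
    -- a central element `x` of `ℂ[G]` and its truncation to `H`
    (x : MonoidAlgebra ℂ G) (hx : x ∈ Subalgebra.center ℂ (MonoidAlgebra ℂ G))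
    (c : ℂ)
    (hc : ρN.asAlgebraHom x = c • (LinearMap.id : N →ₗ[ℂ] N)) :
    ρM.asAlgebraHom (truncateToSubgroup H x) = c • (LinearMap.id : M →ₗ[ℂ] M) := by
  classical
  have := Fintype.ofFinite G
  have := Fintype.ofFinite (G ⧸ H)
  have hk : ∀ g : G, (QuotientGroup.mk g : G ⧸ H).out⁻¹ * g ∈ H := fun g => by
    rw [← QuotientGroup.eq]; simp
  let k : G → H := fun g => ⟨_, hk g⟩
  let Φ : ((G ⧸ H) → M) →ₗ[ℂ] N := ∑ q : G ⧸ H, (ρN q.out ∘ₗ ι) ∘ₗ LinearMap.proj q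
  let T : G → M → ((G ⧸ H) → M) := fun g m => Pi.single (QuotientGroup.mk g) (ρM (k g) m)
  have hT : ∀ g m, Φ (T g m) = ρN g (ι m) := by
    intro g m
    have : Φ (T g m) = ∑ q : G ⧸ H, ρN q.out (ι (T g m q)) := by simp [Φ]
    rw [this, Finset.sum_eq_single (QuotientGroup.mk g)]
    · simp only [T, Pi.single_eq_same]
      rw [hequiv, ← Module.End.mul_apply, ← map_mul]
      simp [k]
    · intro b _ hb
      simp [T, Pi.single_eq_of_ne hb]
    · simp
  have hsurj : Function.Surjective Φ := by
    rw [← LinearMap.range_eq_top, eq_top_iff, ← hgen, Submodule.span_le]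
    rintro _ ⟨g, m, rfl⟩
    exact ⟨T g m, hT g m⟩
  have hΦ : Function.Injective Φ := by
    refine (LinearMap.injective_iff_surjective_of_finrank_eq_finrank ?_).2 hsurj
    rw [hdim, Module.finrank_pi_fintype]
    simp [Subgroup.index, Nat.card_eq_fintype_card]
  ext m
  have key : ∑ g : G, x.coeff g • T g m = c • T 1 m := by
    apply hΦ
    rw [map_sum, map_smul, hT]
    simp only [map_smul, hT]
    rw [← asAlgebraHom_eq_sum, hc]
    simp
  have key1 := congrFun key (QuotientGroup.mk 1)
  have hTH : ∀ h : H, T (h : G) m (QuotientGroup.mk 1) = ρM (k 1) (ρM h m) := by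
    intro h
    have e : (QuotientGroup.mk (h : G) : G ⧸ H) = QuotientGroup.mk 1 := by
      rw [QuotientGroup.eq]; simp
    have e2 : k h = k 1 * h := by
      apply Subtype.ext
      simp only [k, e, Subgroup.coe_mul, mul_one]
    simp only [T, e, Pi.single_eq_same, e2, map_mul, Module.End.mul_apply]
  have hTn : ∀ g : G, g ∉ H → T g m (QuotientGroup.mk 1) = 0 := by
    intro g hg
    apply Pi.single_eq_of_ne
    intro e
    rw [QuotientGroup.eq] at e
    simp at e
    exact hg e
  have key2 : ρM (k 1) (ρM.asAlgebraHom (truncateToSubgroup H x) m) = ρM (k 1) (c • m) := by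
    rw [asAlgebraHom_eq_sum, map_sum, map_smul]
    have h1 := hTH 1
    simp only [map_one, Module.End.one_apply, Subgroup.coe_one] at h1
    rw [← h1, ← Pi.smul_apply, ← key1, Finset.sum_apply]
    simp only [map_smul, ← hTH, Pi.smul_apply]
    symm
    refine (Finset.sum_subset (Finset.subset_univ (Finset.univ.map
      (Function.Embedding.subtype (· ∈ H)))) ?_).symm.trans ?_
    · intro g _ hg
      rw [hTn g, smul_zero]
      simpa using hg
    · rw [Finset.sum_map]
      rfl
  have h3 := congrArg (ρM (k 1)⁻¹) key2
  simpa only [Representation.inv_self_apply, LinearMap.smul_apply, LinearMap.id_apply] using h3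
end

section
/- Suppose in addition that M is irreducible, that Ind_H^{W_n} M is irreducible, that the class sum Σ_{1≤i<j≤n₊} (i j) acts on M by the scalar a, and that Σ_{n₊<i<j≤n} (i j) acts on M by the scalar b. Then the element z_long = Σ_{1≤i<j≤n} ((i j) + (i j)τ_iτ_j) ∈ ℂW_n is central in ℂW_n and acts on Ind_H^{W_n} M by the scalar 2(a + b). -/
/-!
STATEMENT 16. Let W_n = (ℤ/2)ⁿ ⋊ S_n be the hyperoctahedral group, τ_i the generator of
the i-th ℤ/2 factor, n = n₊ + n₋, and H = (ℤ/2)ⁿ ⋊ (S_{n₊} × S_{n₋}) ≤ W_n. Let M be a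
finite-dimensional complex representation of H on which τ_i acts as +1 for i ≤ n₊ and
as −1 for i > n₊. Suppose moreover that M is irreducible, that Ind_H^{W_n} M is
irreducible, that the class sum Σ_{i<j≤n₊} (i j) acts on M by the scalar a, and that
Σ_{n₊<i<j≤n} (i j) acts on M by the scalar b. Then
z_long = Σ_{i<j} ((i j) + (i j)τ_iτ_j) ∈ ℂW_n is central in ℂW_n and acts on
Ind_H^{W_n} M by the scalar 2(a + b).

The induced representation is modelled by any W_n-representation N with an injective
H-equivariant map ι : M → N whose translates span N and with
dim N = [W_n : H]·dim M (this characterizes Ind_H^{W_n} M up to isomorphism).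
-/

abbrev C2 := Multiplicative (ZMod 2)

/-- Coordinate permutation as an automorphism of `(ℤ/2)ⁿ`. -/
def permMulAut (n : ℕ) (σ : Equiv.Perm (Fin n)) : MulAut (Fin n → C2) where
  toFun f := f ∘ σ.symm
  invFun f := f ∘ σ
  left_inv f := by ext x; simp
  right_inv f := by ext x; simp
  map_mul' f g := rfl

/-- The action of `S_n` on `(ℤ/2)ⁿ` by permuting coordinates. -/
def permHom (n : ℕ) : Equiv.Perm (Fin n) →* MulAut (Fin n → C2) where
  toFun := permMulAut n
  map_one' := by
    refine MulEquiv.ext fun f => ?_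
    funext x
    rfl
  map_mul' σ τ := by
    refine MulEquiv.ext fun f => ?_
    funext x
    simp [permMulAut, MulAut.mul_def, Equiv.Perm.mul_def, Equiv.symm_trans_apply]

/-- The hyperoctahedral group `W_n = (ℤ/2)ⁿ ⋊ S_n`. -/
abbrev Wn (n : ℕ) := (Fin n → C2) ⋊[permHom n] Equiv.Perm (Fin n)

/-- The generator τ_i of the i-th (ℤ/2)-factor, as an element of `W_n`. -/
def tau (n : ℕ) (i : Fin n) : Wn n :=
  SemidirectProduct.inl (Pi.mulSingle i (Multiplicative.ofAdd (1 : ZMod 2)))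

/-- The subgroup `S_{n₊} × S_{n₋}` of `S_n`: permutations preserving the block
`{1, …, n₊}` (zero-indexed: `{x | x < n₊}`). -/
def blockPerm (n np : ℕ) : Subgroup (Equiv.Perm (Fin n)) where
  carrier := {σ | ∀ x : Fin n, ((σ x : ℕ) < np ↔ (x : ℕ) < np)}
  one_mem' := by intro x; simp
  mul_mem' := by
    intro a b ha hb x
    exact (ha (b x)).trans (hb x)
  inv_mem' := by
    intro a ha x
    simpa using (ha (a⁻¹ x)).symm

/-- The subgroup `H = (ℤ/2)ⁿ ⋊ (S_{n₊} × S_{n₋})` of `W_n`. -/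
def Hsub (n np : ℕ) : Subgroup (Wn n) :=
  (blockPerm n np).comap (SemidirectProduct.rightHom)

theorem tau_mem (n np : ℕ) (i : Fin n) : tau n i ∈ Hsub n np := by
  simp only [Hsub, Subgroup.mem_comap, tau, SemidirectProduct.rightHom_inl]
  exact one_mem _

/-- The transposition `(i j)`, an element of `S_n ≤ W_n`. -/
def transp (n : ℕ) (i j : Fin n) : Wn n := SemidirectProduct.inr (Equiv.swap i j)

theorem mem_blockPerm {n np : ℕ} {σ : Equiv.Perm (Fin n)} :
    σ ∈ blockPerm n np ↔ ∀ x : Fin n, ((σ x : ℕ) < np ↔ (x : ℕ) < np) := Iff.rfl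

theorem transp_mem (n np : ℕ) (i j : Fin n) (h : ((i : ℕ) < np ↔ (j : ℕ) < np)) :
    transp n i j ∈ Hsub n np := by
  simp only [Hsub, Subgroup.mem_comap, transp, SemidirectProduct.rightHom_inr,
    mem_blockPerm]
  intro x
  rcases eq_or_ne x i with rfl | hxi
  · simp [Equiv.swap_apply_left, h.symm]
  rcases eq_or_ne x j with rfl | hxj
  · simp [Equiv.swap_apply_right, h]
  · simp [Equiv.swap_apply_of_ne_of_ne hxi hxj]

theorem aux_inr_transp (n : ℕ) (σ : Equiv.Perm (Fin n)) (i j : Fin n) :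
    (SemidirectProduct.inr σ : Wn n) * transp n i j
      = transp n (σ i) (σ j) * SemidirectProduct.inr σ := by
  unfold transp
  rw [← map_mul, ← map_mul, Equiv.mul_swap_eq_swap_mul]

theorem aux_inr_tau (n : ℕ) (σ : Equiv.Perm (Fin n)) (i : Fin n) :
    (SemidirectProduct.inr σ : Wn n) * tau n i = tau n (σ i) * SemidirectProduct.inr σ := by
  have key : permHom n σ (Pi.mulSingle i (Multiplicative.ofAdd (1 : ZMod 2)))
      = Pi.mulSingle (σ i) (Multiplicative.ofAdd (1 : ZMod 2)) := by
    funext x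
    change (Pi.mulSingle i (Multiplicative.ofAdd (1 : ZMod 2)) : Fin n → C2) (σ.symm x) = _
    simp only [Pi.mulSingle_apply, Equiv.symm_apply_eq]
  unfold tau
  apply SemidirectProduct.ext
  · simp [key]
  · simp

theorem aux_inl_transp (n : ℕ) (e : Fin n → C2) (i j : Fin n) :
    (SemidirectProduct.inl e : Wn n) * transp n i j
      = transp n i j * SemidirectProduct.inl (e ∘ Equiv.swap i j) := by
  have key : permHom n (Equiv.swap i j) (e ∘ Equiv.swap i j) = e := by
    funext x
    change e (Equiv.swap i j ((Equiv.swap i j).symm x)) = _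
    simp
  unfold transp
  apply SemidirectProduct.ext
  · simp [key]
  · simp

theorem aux_tau_comm (n : ℕ) (i j : Fin n) : tau n i * tau n j = tau n j * tau n i := by
  unfold tau
  rw [← map_mul, ← map_mul, mul_comm]

theorem aux_inl_tau (n : ℕ) (e : Fin n → C2) (i : Fin n) :
    (SemidirectProduct.inl e : Wn n) * tau n i = tau n i * SemidirectProduct.inl e := by
  unfold tau
  rw [← map_mul, ← map_mul, mul_comm]

theorem aux_tau_sq (n : ℕ) (i : Fin n) : tau n i * tau n i = 1 := by
  unfold tau
  rw [← map_mul, ← Pi.mulSingle_mul]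
  have : Multiplicative.ofAdd (1 : ZMod 2) * Multiplicative.ofAdd (1 : ZMod 2) = 1 := by decide
  rw [this]; simp

theorem aux_swap_ne (n : ℕ) (e : Fin n → C2) (i j : Fin n) (h : e i ≠ e j) :
    (SemidirectProduct.inl (e ∘ Equiv.swap i j) : Wn n)
      = tau n i * tau n j * SemidirectProduct.inl e := by
  have hij : i ≠ j := fun h' => h (by rw [h'])
  have c : ∀ x y : C2, x ≠ y → y = Multiplicative.ofAdd (1 : ZMod 2) * x := by decide
  unfold tau
  rw [← map_mul, ← map_mul]
  congr 1
  funext x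
  rcases eq_or_ne x i with rfl | hxi
  · simp [Pi.mulSingle_apply, hij, ← c _ _ h]
  rcases eq_or_ne x j with rfl | hxj
  · simp [Pi.mulSingle_apply, hij.symm, ← c _ _ h.symm]
  · simp [Equiv.swap_apply_of_ne_of_ne hxi hxj, Pi.mulSingle_apply, hxi, hxj]

theorem aux_swap_eq (n : ℕ) (e : Fin n → C2) (i j : Fin n) (h : e i = e j) :
    e ∘ Equiv.swap i j = e := by
  funext x
  rcases eq_or_ne x i with rfl | hxi
  · simp [h]
  rcases eq_or_ne x j with rfl | hxj
  · simp [h]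
  · simp [Equiv.swap_apply_of_ne_of_ne hxi hxj]

/-- The summand `(i j) + (i j)τ_iτ_j`. -/
noncomputable def auxF (n : ℕ) (i j : Fin n) : MonoidAlgebra ℂ (Wn n) :=
  MonoidAlgebra.single (transp n i j) (1 : ℂ) +
    MonoidAlgebra.single (transp n i j * tau n i * tau n j) (1 : ℂ)

theorem auxF_symm (n : ℕ) (i j : Fin n) : auxF n i j = auxF n j i := by
  unfold auxF
  have h : transp n i j = transp n j i := by unfold transp; rw [Equiv.swap_comm]
  rw [h, mul_assoc, aux_tau_comm, ← mul_assoc]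

theorem auxF_inr (n : ℕ) (σ : Equiv.Perm (Fin n)) (i j : Fin n) :
    MonoidAlgebra.single (SemidirectProduct.inr σ : Wn n) (1 : ℂ) * auxF n i j
      = auxF n (σ i) (σ j) * MonoidAlgebra.single (SemidirectProduct.inr σ : Wn n) (1 : ℂ) := by
  unfold auxF
  simp only [mul_add, add_mul, MonoidAlgebra.single_mul_single, mul_one]
  rw [← mul_assoc, ← mul_assoc, aux_inr_transp, mul_assoc _ _ (tau n i), aux_inr_tau,
    ← mul_assoc, mul_assoc _ _ (tau n j), aux_inr_tau, ← mul_assoc]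

theorem auxF_inl (n : ℕ) (e : Fin n → C2) (i j : Fin n) :
    MonoidAlgebra.single (SemidirectProduct.inl e : Wn n) (1 : ℂ) * auxF n i j
      = auxF n i j * MonoidAlgebra.single (SemidirectProduct.inl e : Wn n) (1 : ℂ) := by
  unfold auxF
  simp only [mul_add, add_mul, MonoidAlgebra.single_mul_single, mul_one]
  rw [← mul_assoc, ← mul_assoc, aux_inl_transp]
  by_cases h : e i = e j
  · rw [aux_swap_eq n e i j h, mul_assoc _ _ (tau n i), aux_inl_tau,
      ← mul_assoc, mul_assoc _ _ (tau n j), aux_inl_tau, ← mul_assoc]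
  · rw [aux_swap_ne n e i j h, add_comm]
    have h2 : transp n i j * (tau n i * tau n j * SemidirectProduct.inl e) * tau n i * tau n j
        = transp n i j * SemidirectProduct.inl e := by
      calc _ = transp n i j * (tau n i * tau n j *
            ((SemidirectProduct.inl e * tau n i) * tau n j)) := by simp only [mul_assoc]
        _ = transp n i j * (tau n i * tau n j *
            (tau n i * (SemidirectProduct.inl e * tau n j))) := by
              rw [aux_inl_tau]; simp only [mul_assoc]
        _ = transp n i j * ((tau n i * tau n j) *
            (tau n i * tau n j) * SemidirectProduct.inl e) := by
              rw [aux_inl_tau]; simp only [mul_assoc]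
        _ = transp n i j * ((tau n i * tau n j) *
            (tau n j * tau n i) * SemidirectProduct.inl e) := by rw [aux_tau_comm n j i]
        _ = transp n i j * (tau n i * (tau n j *
            tau n j) * tau n i * SemidirectProduct.inl e) := by simp only [mul_assoc]
        _ = _ := by rw [aux_tau_sq, mul_one, aux_tau_sq, one_mul]
    rw [h2]
    simp only [mul_assoc]

/-- The element `z_long`. -/
noncomputable def auxZ (n : ℕ) : MonoidAlgebra ℂ (Wn n) :=
  ∑ p ∈ Finset.univ.filter (fun p : Fin n × Fin n => p.1 < p.2), auxF n p.1 p.2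

theorem auxZ_two (n : ℕ) : (2 : ℂ) • auxZ n =
    ∑ p ∈ Finset.univ.filter (fun p : Fin n × Fin n => p.1 ≠ p.2), auxF n p.1 p.2 := by
  have h1 : Finset.univ.filter (fun p : Fin n × Fin n => p.1 ≠ p.2)
      = Finset.univ.filter (fun p : Fin n × Fin n => p.1 < p.2) ∪
        Finset.univ.filter (fun p : Fin n × Fin n => p.2 < p.1) := by
    ext p; simp [lt_or_lt_iff_ne]
  rw [h1, Finset.sum_union, two_smul]
  · unfold auxZ
    congr 1
    refine Finset.sum_equiv (Equiv.prodComm _ _) ?_ ?_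
    · intro p; simp
    · intro p _; exact auxF_symm n _ _
  · rw [Finset.disjoint_left]
    intro p hp hq
    simp only [Finset.mem_filter] at hp hq
    exact lt_asymm hp.2 hq.2

theorem auxZ_inr (n : ℕ) (σ : Equiv.Perm (Fin n)) :
    MonoidAlgebra.single (SemidirectProduct.inr σ : Wn n) (1 : ℂ) * auxZ n
      = auxZ n * MonoidAlgebra.single (SemidirectProduct.inr σ : Wn n) (1 : ℂ) := by
  have h2 : (2 : ℂ) ≠ 0 := two_ne_zero
  apply smul_right_injective _ h2
  simp only
  rw [← mul_smul_comm, ← smul_mul_assoc, auxZ_two, Finset.mul_sum, Finset.sum_mul]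
  refine Finset.sum_equiv (Equiv.prodCongr σ σ) ?_ ?_
  · intro p; simp
  · intro p _; exact auxF_inr n σ _ _

theorem auxZ_single (n : ℕ) (g : Wn n) :
    MonoidAlgebra.single g (1 : ℂ) * auxZ n = auxZ n * MonoidAlgebra.single g (1 : ℂ) := by
  have hl : MonoidAlgebra.single (SemidirectProduct.inl g.left : Wn n) (1 : ℂ) * auxZ n
      = auxZ n * MonoidAlgebra.single (SemidirectProduct.inl g.left : Wn n) (1 : ℂ) := by
    unfold auxZ
    rw [Finset.mul_sum, Finset.sum_mul]
    exact Finset.sum_congr rfl fun p _ => auxF_inl n _ _ _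
  have hg : MonoidAlgebra.single g (1 : ℂ) =
      MonoidAlgebra.single (SemidirectProduct.inl g.left : Wn n) (1 : ℂ) *
      MonoidAlgebra.single (SemidirectProduct.inr g.right : Wn n) (1 : ℂ) := by
    rw [MonoidAlgebra.single_mul_single, SemidirectProduct.inl_left_mul_inr_right, one_mul]
  rw [hg, mul_assoc, auxZ_inr, ← mul_assoc, hl, mul_assoc]

theorem auxZ_center (n : ℕ) : auxZ n ∈ Subalgebra.center ℂ (MonoidAlgebra ℂ (Wn n)) := by
  rw [Subalgebra.mem_center_iff]
  intro x
  induction x using MonoidAlgebra.induction_on with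
  | of g => exact auxZ_single n g
  | add x y hx hy => rw [add_mul, mul_add, hx, hy]
  | smul r x hx => rw [smul_mul_assoc, hx, mul_smul_comm]

theorem stmt_16 (n np nm : ℕ) (hn : n = np + nm)
    {M N : Type*} [AddCommGroup M] [Module ℂ M] [FiniteDimensional ℂ M]
    [AddCommGroup N] [Module ℂ N] [FiniteDimensional ℂ N]
    (ρM : Representation ℂ (Hsub n np) M) (ρN : Representation ℂ (Wn n) N)
    -- τ_i acts on M as +1 for i ≤ n₊ and as −1 for i > n₊ (zero-indexed: i < n₊ resp. n₊ ≤ i)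
    (hτpos : ∀ i : Fin n, (i : ℕ) < np →
      ρM ⟨tau n i, tau_mem n np i⟩ = (LinearMap.id : M →ₗ[ℂ] M))
    (hτneg : ∀ i : Fin n, np ≤ (i : ℕ) →
      ρM ⟨tau n i, tau_mem n np i⟩ = -(LinearMap.id : M →ₗ[ℂ] M))
    -- `(N, ι)` is a model of the induced representation `Ind_H^{W_n} M`:
    (ι : M →ₗ[ℂ] N)
    (hinj : Function.Injective ι)
    (hequiv : ∀ (h : Hsub n np) (m : M), ι (ρM h m) = ρN (h : Wn n) (ι m))
    (hgen : Submodule.span ℂ {v : N | ∃ (g : Wn n) (m : M), v = ρN g (ι m)} = ⊤)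
    (hdim : Module.finrank ℂ N = (Hsub n np).index * Module.finrank ℂ M)
    -- M and Ind_H^{W_n} M are irreducible
    (hMirr : IsSimpleModule (MonoidAlgebra ℂ (Hsub n np)) ρM.asModule)
    (hNirr : IsSimpleModule (MonoidAlgebra ℂ (Wn n)) ρN.asModule)
    -- the class sum Σ_{i<j≤n₊} (i j) acts on M by the scalar a
    (a b : ℂ)
    (ha : ρM.asAlgebraHom
        (∑ p ∈ Finset.univ.filter (fun p : Fin n × Fin n => p.1 < p.2 ∧ (p.2 : ℕ) < np),
          if h : ((p.1 : ℕ) < np ↔ (p.2 : ℕ) < np) then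
            MonoidAlgebra.single (⟨transp n p.1 p.2, transp_mem n np p.1 p.2 h⟩ :
              Hsub n np) (1 : ℂ)
          else 0) = a • (LinearMap.id : M →ₗ[ℂ] M))
    -- the class sum Σ_{n₊<i<j≤n} (i j) acts on M by the scalar b
    (hb : ρM.asAlgebraHom
        (∑ p ∈ Finset.univ.filter (fun p : Fin n × Fin n => p.1 < p.2 ∧ np ≤ (p.1 : ℕ)),
          if h : ((p.1 : ℕ) < np ↔ (p.2 : ℕ) < np) then
            MonoidAlgebra.single (⟨transp n p.1 p.2, transp_mem n np p.1 p.2 h⟩ :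
              Hsub n np) (1 : ℂ)
          else 0) = b • (LinearMap.id : M →ₗ[ℂ] M)) :
    -- z_long = Σ_{i<j} ((i j) + (i j)τ_iτ_j) is central and acts on Ind by 2(a+b)
    (∑ p ∈ Finset.univ.filter (fun p : Fin n × Fin n => p.1 < p.2),
        (MonoidAlgebra.single (transp n p.1 p.2) (1 : ℂ) +
          MonoidAlgebra.single (transp n p.1 p.2 * tau n p.1 * tau n p.2) (1 : ℂ))) ∈
      Subalgebra.center ℂ (MonoidAlgebra ℂ (Wn n)) ∧
    ρN.asAlgebraHom
        (∑ p ∈ Finset.univ.filter (fun p : Fin n × Fin n => p.1 < p.2),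
          (MonoidAlgebra.single (transp n p.1 p.2) (1 : ℂ) +
            MonoidAlgebra.single (transp n p.1 p.2 * tau n p.1 * tau n p.2) (1 : ℂ))) =
      (2 * (a + b)) • (LinearMap.id : N →ₗ[ℂ] N) := by
  change auxZ n ∈ Subalgebra.center ℂ (MonoidAlgebra ℂ (Wn n)) ∧
    ρN.asAlgebraHom (auxZ n) = (2 * (a + b)) • (LinearMap.id : N →ₗ[ℂ] N)
  refine ⟨auxZ_center n, ?_⟩
  have hF : ∀ (i j : Fin n) (v : N), ρN.asAlgebraHom (auxF n i j) v
      = ρN (transp n i j) v + ρN (transp n i j) (ρN (tau n i) (ρN (tau n j) v)) := by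
    intro i j v
    simp [auxF, Representation.asAlgebraHom_single, map_mul]
  have hpos : ∀ (i : Fin n) (m : M), (i : ℕ) < np → ρN (tau n i) (ι m) = ι m := by
    intro i m hi
    have := hequiv ⟨tau n i, tau_mem n np i⟩ m
    rw [hτpos i hi] at this
    exact this.symm
  have hneg : ∀ (i : Fin n) (m : M), np ≤ (i : ℕ) → ρN (tau n i) (ι m) = - ι m := by
    intro i m hi
    have := hequiv ⟨tau n i, tau_mem n np i⟩ m
    rw [hτneg i hi] at this
    simpa using this.symm
  have hsum : ∀ (P : Fin n × Fin n → Prop) [DecidablePred P] (c : ℂ),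
      (∀ p, P p → ((p.1 : ℕ) < np ↔ (p.2 : ℕ) < np)) →
      ρM.asAlgebraHom
        (∑ p ∈ Finset.univ.filter P,
          if h : ((p.1 : ℕ) < np ↔ (p.2 : ℕ) < np) then
            MonoidAlgebra.single (⟨transp n p.1 p.2, transp_mem n np p.1 p.2 h⟩ :
              Hsub n np) (1 : ℂ)
          else 0) = c • (LinearMap.id : M →ₗ[ℂ] M) →
      ∀ m : M, ∑ p ∈ Finset.univ.filter P, ρN (transp n p.1 p.2) (ι m) = c • ι m := by
    intro P _ c hP hc m
    have h1 := congrArg ι (LinearMap.congr_fun hc m)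
    rw [map_sum, LinearMap.sum_apply, map_sum] at h1
    simp only [LinearMap.smul_apply, LinearMap.id_apply, map_smul] at h1
    rw [← h1]
    refine Finset.sum_congr rfl fun p hp => ?_
    have h := hP p (Finset.mem_filter.1 hp).2
    rw [dif_pos h, Representation.asAlgebraHom_single, one_smul, hequiv]
  have hA := hsum _ a (by intro p hp; have := hp.1; have := hp.2; omega) ha
  have hB := hsum _ b (by intro p hp; have := hp.1; have := hp.2; omega) hb
  have hM : ∀ m : M, ρN.asAlgebraHom (auxZ n) (ι m) = (2 * (a + b)) • ι m := by
    intro m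
    rw [mul_smul, add_smul, ← hA m, ← hB m]
    simp only [Finset.sum_filter]
    rw [← Finset.sum_add_distrib, Finset.smul_sum]
    unfold auxZ
    rw [Finset.sum_filter, map_sum, LinearMap.sum_apply]
    refine Finset.sum_congr rfl fun p _ => ?_
    by_cases hlt : p.1 < p.2
    · have hlt' : (p.1 : ℕ) < p.2 := hlt
      rw [if_pos hlt, hF]
      by_cases h1 : (p.1 : ℕ) < np
      · by_cases h2 : (p.2 : ℕ) < np
        · rw [hpos _ _ h2, hpos _ _ h1]
          simp [hlt, h2, not_le.2 h1, two_smul]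
        · rw [hneg _ _ (not_lt.1 h2), map_neg, hpos _ _ h1]
          simp [h2, not_le.2 h1]
      · have h2 : ¬ (p.2 : ℕ) < np := by omega
        rw [hneg _ _ (not_lt.1 h2), map_neg, hneg _ _ (not_lt.1 h1)]
        simp [hlt, h2, not_lt.1 h1, two_smul]
    · simp [hlt]
  apply LinearMap.ext_on_range (v := fun x : Wn n × M => ρN x.1 (ι x.2))
  · rw [← hgen]
    congr 1
    ext v
    simp [eq_comm]
  · rintro ⟨g, m⟩
    have hc := congrArg (fun x => ρN.asAlgebraHom x (ι m)) (auxZ_single n g)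
    simp only [map_mul, Representation.asAlgebraHom_single, one_smul, Module.End.mul_apply] at hc
    simp only
    rw [← hc, hM]
    simp
end
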